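/- arXiv:2001.08476 — 3 statements merged into one kernel-verified Lean document; each statement's English description precedes it below -/
import Mathlib

section
/- Under the stated conditions on (γ, χ, α_0,…,α_N), for every fixed (t,𝐭) with t < t_1 < ⋯ < t_N the integrand (x_1,…,x_l) ↦ ∏_{s=1}^l ∏_{i=0}^N (x_s − t_i)^{−γα_i/2} · ∏_{1≤s'<s≤l} (x_s − x_{s'})^{−γ²/2} is absolutely integrable over the simplex {t_{N−1} < x_1 < ⋯ < x_l < t_N}, and the function (t,𝐭) ↦ C^{(l)}(t,𝐭) is r times continuously differentiable on the ordered domain {t < t_1 < ⋯ < t_N}. -/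
open scoped BigOperators
open MeasureTheory

/-- The open simplex `{x : a < x₁ < ⋯ < x_l < b}`. -/
def Simplex (l : ℕ) (a b : ℝ) : Set (Fin l → ℝ) :=
  {x | StrictMono x ∧ ∀ s, a < x s ∧ x s < b}

/-- The integrand of the real Coulomb gas integral:
`∏_{s,i} (x_s − T_i)^{−γα_i/2} · ∏_{s'<s} (x_s − x_{s'})^{−γ²/2}`,
where `T : Fin (N+1) → ℝ` collects `t₀ = t, t₁, …, t_N`. -/
noncomputable def CGint (l N : ℕ) (γ : ℂ) (α : Fin (N + 1) → ℂ)
    (T : Fin (N + 1) → ℝ) (x : Fin l → ℝ) : ℂ :=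
  (∏ s : Fin l, ∏ i : Fin (N + 1), (((x s - T i : ℝ) : ℂ) ^ (-(γ * α i) / 2))) *
    ∏ s : Fin l, ∏ s' ∈ Finset.Iio s, (((x s - x s' : ℝ) : ℂ) ^ (-(γ ^ 2) / 2))

/-- The full coordinate vector `T = (t₀, t₁, …, t_N)` with `t₀ = t`. -/
def Tfull {N : ℕ} (p : ℝ × (Fin N → ℝ)) : Fin (N + 1) → ℝ := Fin.cons p.1 p.2

/-- The real Coulomb gas integral
`C^{(l)}(t,𝐭) = ∏_{0≤i<j≤N} (t_j − t_i)^{−α_iα_j/2} ·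
∫_{t_{N−1}<x₁<⋯<x_l<t_N} ∏_{s,i}(x_s − t_i)^{−γα_i/2} ∏_{s'<s}(x_s − x_{s'})^{−γ²/2} dx`. -/
noncomputable def CoulombC (l N : ℕ) (hN : 2 ≤ N) (γ : ℂ) (α : Fin (N + 1) → ℂ)
    (p : ℝ × (Fin N → ℝ)) : ℂ :=
  (∏ i : Fin (N + 1), ∏ j ∈ Finset.Ioi i,
      (((Tfull p j - Tfull p i : ℝ) : ℂ) ^ (-(α i * α j) / 2))) *
    ∫ x in Simplex l (p.2 ⟨N - 2, by omega⟩) (p.2 ⟨N - 1, by omega⟩),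
      CGint l N γ α (Tfull p) x

/-- The ordered domain `{t < t₁ < ⋯ < t_N}`. -/
def OrdDomain (N : ℕ) : Set (ℝ × (Fin N → ℝ)) :=
  {p | (∀ l, p.1 < p.2 l) ∧ StrictMono p.2}

/-- A parametric integral over a set `S` with compact closure `K`, whose integrand is the product of
an integrable kernel and a function that is `C^n` on a neighbourhood of `U × K`, is `C^n` on `U`. -/
theorem contDiffOn_setIntegral_mul {E X : Type*} [NormedAddCommGroup E] [NormedSpace ℝ E]
    [NormedAddCommGroup X] [NormedSpace ℝ X] [FiniteDimensional ℝ X] [MeasurableSpace X]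
    [BorelSpace X] {μ : Measure X} {n : ℕ∞} {U : Set E} {S K : Set X} {W : Set (E × X)}
    {k : X → ℂ} {F : E × X → ℂ} (hK : IsCompact K) (hS : MeasurableSet S)
    (hSK : S ⊆ K) (hW : IsOpen W) (hUW : U ×ˢ K ⊆ W) (hk : IntegrableOn k S μ)
    (hF : ContDiffOn ℝ n F W) :
    ContDiffOn ℝ n (fun p => ∫ x in S, k x * F (p, x) ∂μ) U := by
  intro p₀ hp₀
  obtain ⟨U₀, V, hU₀, hV, hpU₀, hKV, hUV⟩ := generalized_tube_lemma (isCompact_singleton (x := p₀))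
    hK hW ((Set.prod_mono_left (Set.singleton_subset_iff.2 hp₀)).trans hUW)
  obtain ⟨K', hK', hKK', hK'V⟩ := exists_compact_between hK hV hKV
  obtain ⟨φ, hφ1, hφ0, -⟩ := exists_contMDiffMap_one_nhds_of_subset_interior (n := n)
    (modelWithCornersSelf ℝ X) hK.isClosed hKK'
  have hφ : ContDiff ℝ n φ := φ.contMDiff.contDiff
  let g : E → X → ℂ := fun p y => (φ (-y) : ℂ) * F (p, -y)
  have hg : ContDiffOn ℝ n (Function.uncurry g) (U₀ ×ˢ Set.univ) := by
    rintro ⟨p, y⟩ ⟨hp, -⟩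
    refine ContDiffAt.contDiffWithinAt ?_
    by_cases hy : -y ∈ V
    · have hFa : ContDiffAt ℝ n F (p, -y) := hF.contDiffAt (hW.mem_nhds (hUV ⟨hp, hy⟩))
      refine ContDiffAt.mul ?_ ?_
      · exact (Complex.ofRealCLM.contDiff.comp (hφ.comp contDiff_snd.neg)).contDiffAt
      · exact ContDiffAt.comp (p, y) hFa (contDiff_fst.prodMk contDiff_snd.neg).contDiffAt
    · have hev : Function.uncurry g =ᶠ[nhds (p, y)] fun _ => 0 := by
        have : ∀ᶠ q : E × X in nhds (p, y), -q.2 ∈ K'ᶜ :=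
          (continuous_snd.neg.continuousAt (x := (p, y))).eventually_mem
            (hK'.isClosed.isOpen_compl.mem_nhds fun h => hy (hK'V h))
        filter_upwards [this] with q hq
        simp [Function.uncurry, g, hφ0 _ hq]
      exact contDiffAt_const.congr_of_eventuallyEq hev
  have hconv := contDiffOn_convolution_right_with_param (μ := μ) (ContinuousLinearMap.mul ℝ ℂ)
    (f := S.indicator k) (g := g) (k := -K') hU₀ hK'.neg
    (fun p x _ hx => by simp [g, hφ0 (-x) (by simpa using hx)])
    ((integrable_indicator_iff hS).2 hk).locallyIntegrable hg
  have hcomp : ContDiffAt ℝ n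
      (fun p => convolution (S.indicator k) (g p) (ContinuousLinearMap.mul ℝ ℂ) μ 0) p₀ :=
    ContDiffAt.comp p₀ (g := fun q : E × X =>
        convolution (S.indicator k) (g q.1) (ContinuousLinearMap.mul ℝ ℂ) μ q.2)
      (f := fun p => (p, (0 : X)))
      (hconv.contDiffAt ((hU₀.prod isOpen_univ).mem_nhds ⟨hpU₀ rfl, trivial⟩))
      (contDiff_id.prodMk contDiff_const).contDiffAt
  refine (hcomp.congr_of_eventuallyEq (Filter.Eventually.of_forall fun p => ?_)).contDiffWithinAt
  simp only [convolution]
  rw [← integral_indicator hS]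
  congr 1 with x
  by_cases hx : x ∈ S
  · have h1 : φ x = 1 := (hφ1.self_of_nhdsSet) x (hSK hx)
    simp [hx, g, h1]
  · simp [hx]

theorem ofReal_pos_mul_cpow {R : ℝ} (hR : 0 < R) (y : ℝ) (c : ℂ) :
    ((R * y : ℝ) : ℂ) ^ c = (R : ℂ) ^ c * (y : ℂ) ^ c := by
  rcases eq_or_ne y 0 with rfl | hy
  · rcases eq_or_ne c 0 with rfl | hc <;> simp [*]
  · have hR' : (R : ℂ) ≠ 0 := by exact_mod_cast hR.ne'
    have hy' : (y : ℂ) ≠ 0 := by exact_mod_cast hy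
    rw [Complex.ofReal_mul, Complex.cpow_def_of_ne_zero (mul_ne_zero hR' hy'),
      Complex.cpow_def_of_ne_zero hR', Complex.cpow_def_of_ne_zero hy', ← Complex.exp_add,
      Complex.log_ofReal_mul hR hy', Complex.ofReal_log hR.le, add_mul]

theorem ContDiffOn.ofReal_cpow_const {E : Type*} [NormedAddCommGroup E] [NormedSpace ℝ E]
    {n : WithTop ℕ∞} {f : E → ℝ} {W : Set E} (hf : ContDiffOn ℝ n f W) (hpos : ∀ p ∈ W, 0 < f p)
    (c : ℂ) : ContDiffOn ℝ n (fun p => ((f p : ℝ) : ℂ) ^ c) W := by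
  have h : ContDiffOn ℝ n (fun p => Complex.exp (((Real.log (f p) : ℝ) : ℂ) * c)) W :=
    ((Complex.ofRealCLM.contDiff.comp_contDiffOn
      (hf.log fun p hp => (hpos p hp).ne')).mul contDiffOn_const).cexp
  refine h.congr fun p hp => ?_
  rw [Complex.cpow_def_of_ne_zero (by exact_mod_cast (hpos p hp).ne'),
    Complex.ofReal_log (hpos p hp).le]

theorem norm_ofReal_cpow_ofReal_le_one {x c : ℝ} (hx : |x| ≤ 1) (hc : 0 ≤ c) :
    ‖(x : ℂ) ^ (c : ℂ)‖ ≤ 1 := by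
  rw [Complex.norm_cpow_real, Complex.norm_real]
  exact Real.rpow_le_one (norm_nonneg _) hx hc

theorem isOpen_simplex (l : ℕ) (a b : ℝ) : IsOpen (Simplex l a b) := by
  have : Simplex l a b =
      (⋂ i : Fin l, ⋂ j : Fin l, ⋂ _ : i < j, {x : Fin l → ℝ | x i < x j}) ∩
        ⋂ s : Fin l, {x : Fin l → ℝ | a < x s ∧ x s < b} := by
    ext x
    simp only [Simplex, Set.mem_ofPred_eq, StrictMono, Set.mem_inter_iff, Set.mem_iInter]
  rw [this]
  refine IsOpen.inter ?_ ?_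
  · refine isOpen_iInter_of_finite fun i => isOpen_iInter_of_finite fun j =>
      isOpen_iInter_of_finite fun _ => isOpen_lt (continuous_apply i) (continuous_apply j)
  · refine isOpen_iInter_of_finite fun s => ?_
    exact (isOpen_lt continuous_const (continuous_apply s)).inter
      (isOpen_lt (continuous_apply s) continuous_const)

theorem simplex_subset_Icc (l : ℕ) (a b : ℝ) :
    Simplex l a b ⊆ Set.Icc (fun _ => a) (fun _ => b) :=
  fun _ hx => ⟨fun s => (hx.2 s).1.le, fun s => (hx.2 s).2.le⟩

theorem add_smul_mem_simplex_iff {l : ℕ} {a b : ℝ} (hab : a < b) (u : Fin l → ℝ) :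
    (fun _ => a) + (b - a) • u ∈ Simplex l a b ↔ u ∈ Simplex l 0 1 := by
  have hR : 0 < b - a := sub_pos.2 hab
  simp only [Simplex, Set.mem_ofPred_eq, StrictMono, Pi.add_apply, Pi.smul_apply, smul_eq_mul,
    add_lt_add_iff_left, mul_lt_mul_iff_right₀ hR, lt_add_iff_pos_right, mul_pos_iff_of_pos_left hR]
  refine and_congr_right fun _ => forall_congr' fun s => and_congr_right fun _ => ?_
  rw [← lt_sub_iff_add_lt', mul_lt_iff_lt_one_right hR]

theorem indicator_simplex_add_smul {l : ℕ} {a b : ℝ} (hab : a < b) (f : (Fin l → ℝ) → ℂ)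
    (u : Fin l → ℝ) :
    (Simplex l a b).indicator f ((fun _ => a) + (b - a) • u) =
      (Simplex l 0 1).indicator (fun u => f ((fun _ => a) + (b - a) • u)) u := by
  by_cases hu : u ∈ Simplex l 0 1
  · rw [Set.indicator_of_mem hu, Set.indicator_of_mem ((add_smul_mem_simplex_iff hab u).2 hu)]
  · rw [Set.indicator_of_notMem hu,
      Set.indicator_of_notMem (mt (add_smul_mem_simplex_iff hab u).1 hu)]

theorem integrableOn_simplex_iff {l : ℕ} {a b : ℝ} (hab : a < b) (f : (Fin l → ℝ) → ℂ) :
    IntegrableOn f (Simplex l a b) ↔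
      IntegrableOn (fun u => f ((fun _ => a) + (b - a) • u)) (Simplex l 0 1) := by
  rw [← integrable_indicator_iff (isOpen_simplex l a b).measurableSet,
    ← integrable_indicator_iff (isOpen_simplex l 0 1).measurableSet,
    ← (measurePreserving_add_left volume fun _ : Fin l => a).integrable_comp_emb
      (measurableEmbedding_addLeft _),
    ← integrable_comp_smul_iff volume _ (sub_pos.2 hab).ne']
  exact iff_of_eq (congrArg (Integrable · volume)
    (funext fun u => indicator_simplex_add_smul hab f u))

theorem setIntegral_simplex {l : ℕ} {a b : ℝ} (hab : a < b) (f : (Fin l → ℝ) → ℂ) :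
    ∫ x in Simplex l a b, f x =
      ((b - a : ℝ) : ℂ) ^ l * ∫ u in Simplex l 0 1, f ((fun _ => a) + (b - a) • u) := by
  have hR : 0 < b - a := sub_pos.2 hab
  rw [← integral_indicator (isOpen_simplex l a b).measurableSet,
    ← integral_indicator (isOpen_simplex l 0 1).measurableSet,
    ← integral_add_left_eq_self (μ := volume) ((Simplex l a b).indicator f) (fun _ => a)]
  have h := Measure.integral_comp_smul_of_nonneg (volume : Measure (Fin l → ℝ))
    (fun y => (Simplex l a b).indicator f ((fun _ => a) + y)) (b - a) (hR := hR.le)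
  simp only [indicator_simplex_add_smul hab] at h
  rw [h, Module.finrank_fintype_fun_eq_card, Fintype.card_fin, Complex.real_smul, ← mul_assoc]
  push_cast
  rw [mul_inv_cancel₀ (pow_ne_zero _ (by exact_mod_cast hR.ne')), one_mul]

theorem tfull_strictMono {N : ℕ} {p : ℝ × (Fin N → ℝ)} (hp : p ∈ OrdDomain N) :
    StrictMono (Tfull p) := by
  intro i j hij
  induction j using Fin.cases with
  | zero => exact absurd hij (Fin.not_lt_zero i)
  | succ j =>
    induction i using Fin.cases with
    | zero => exact hp.1 j
    | succ i => exact hp.2 (Fin.succ_lt_succ_iff.1 hij)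

theorem contDiff_tfull {N : ℕ} {n : WithTop ℕ∞} (i : Fin (N + 1)) :
    ContDiff ℝ n (fun p : ℝ × (Fin N → ℝ) => Tfull p i) := by
  induction i using Fin.cases with
  | zero => exact contDiff_fst
  | succ i => exact (contDiff_apply ℝ ℝ i).comp contDiff_snd

/-- The part of the rescaled integrand on the unit simplex that does not depend on the `t_i`; here
`c`, `c'` are the exponents at the two endpoints and `d` is the exponent of the differences. -/
noncomputable def simplexKernel (l : ℕ) (c c' d : ℂ) (u : Fin l → ℝ) : ℂ :=
  (∏ s : Fin l, ((u s : ℝ) : ℂ) ^ c * ((u s - 1 : ℝ) : ℂ) ^ c') *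
    ∏ s : Fin l, ∏ s' ∈ Finset.Iio s, ((u s - u s' : ℝ) : ℂ) ^ d

theorem integrableOn_simplexKernel (l : ℕ) {c c' d : ℝ} (hc : 0 ≤ c) (hc' : 0 ≤ c')
    (hd : 0 ≤ d) : IntegrableOn (simplexKernel l c c' d) (Simplex l 0 1) := by
  have hfin : volume (Simplex l 0 1) < ⊤ :=
    (measure_mono (simplex_subset_Icc l 0 1)).trans_lt isCompact_Icc.measure_lt_top
  refine IntegrableOn.of_bound hfin ?_ 1 ?_
  · refine Measurable.aestronglyMeasurable ?_
    unfold simplexKernel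
    fun_prop
  · refine (ae_restrict_iff' (isOpen_simplex l 0 1).measurableSet).2 (ae_of_all _ fun u hu => ?_)
    have h := fun s => hu.2 s
    rw [simplexKernel, norm_mul, norm_prod, norm_prod]
    refine mul_le_one₀ (Finset.prod_le_one (fun _ _ => norm_nonneg _) fun s _ => ?_)
      (Finset.prod_nonneg fun _ _ => norm_nonneg _)
      (Finset.prod_le_one (fun _ _ => norm_nonneg _) fun s _ => ?_)
    · rw [norm_mul]
      refine mul_le_one₀ (norm_ofReal_cpow_ofReal_le_one ?_ hc) (norm_nonneg _)
        (norm_ofReal_cpow_ofReal_le_one ?_ hc') <;>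
      · rw [abs_le]; constructor <;> linarith [(h s).1, (h s).2]
    · rw [norm_prod]
      refine Finset.prod_le_one (fun _ _ => norm_nonneg _) fun s' _ =>
        norm_ofReal_cpow_ofReal_le_one ?_ hd
      rw [abs_le]; constructor <;> linarith [(h s).1, (h s).2, (h s').1, (h s').2]

/-- The rescaled factors of the integrand coming from the points `t_0, …, t_{N-2}`
(with `N = M + 2`), viewed as a function of the parameters and of the rescaled variables. -/
noncomputable def regularFactor (l M : ℕ) (c : Fin (M + 1) → ℂ)
    (q : (ℝ × (Fin (M + 2) → ℝ)) × (Fin l → ℝ)) : ℂ :=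
  ∏ s : Fin l, ∏ i : Fin (M + 1),
    ((Tfull q.1 (Fin.last (M + 1)).castSucc +
      (Tfull q.1 (Fin.last (M + 2)) - Tfull q.1 (Fin.last (M + 1)).castSucc) * q.2 s -
      Tfull q.1 i.castSucc.castSucc : ℝ) : ℂ) ^ c i

/-- The open set on which all the bases of the powers in `regularFactor` are positive. -/
def regularSet (l M : ℕ) : Set ((ℝ × (Fin (M + 2) → ℝ)) × (Fin l → ℝ)) :=
  {q | ∀ s : Fin l, ∀ i : Fin (M + 1),
    0 < Tfull q.1 (Fin.last (M + 1)).castSucc +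
      (Tfull q.1 (Fin.last (M + 2)) - Tfull q.1 (Fin.last (M + 1)).castSucc) * q.2 s -
      Tfull q.1 i.castSucc.castSucc}

theorem contDiff_regularFactor_base {l M : ℕ} {n : WithTop ℕ∞} (s : Fin l) (i : Fin (M + 1)) :
    ContDiff ℝ n fun q : (ℝ × (Fin (M + 2) → ℝ)) × (Fin l → ℝ) =>
      Tfull q.1 (Fin.last (M + 1)).castSucc +
      (Tfull q.1 (Fin.last (M + 2)) - Tfull q.1 (Fin.last (M + 1)).castSucc) * q.2 s -
      Tfull q.1 i.castSucc.castSucc := by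
  have hT : ∀ i, ContDiff ℝ n fun q : (ℝ × (Fin (M + 2) → ℝ)) × (Fin l → ℝ) => Tfull q.1 i :=
    fun i => (contDiff_tfull i).comp contDiff_fst
  exact ((hT _).add (((hT _).sub (hT _)).mul ((contDiff_apply ℝ ℝ s).comp contDiff_snd))).sub (hT _)

theorem isOpen_regularSet (l M : ℕ) : IsOpen (regularSet l M) := by
  simp only [regularSet, Set.ofPred_forall]
  exact isOpen_iInter_of_finite fun s => isOpen_iInter_of_finite fun i =>
    isOpen_lt continuous_const (contDiff_regularFactor_base (n := 0) s i).continuous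

theorem contDiffOn_regularFactor {l M : ℕ} {n : WithTop ℕ∞} (c : Fin (M + 1) → ℂ) :
    ContDiffOn ℝ n (regularFactor l M c) (regularSet l M) :=
  contDiffOn_prod fun s _ => contDiffOn_prod fun i _ =>
    (contDiff_regularFactor_base s i).contDiffOn.ofReal_cpow_const (fun q (hq : q ∈ regularSet l M) => hq s i) (c i)

theorem ordDomain_prod_Icc_subset_regularSet (l M : ℕ) :
    OrdDomain (M + 2) ×ˢ Set.Icc (fun _ : Fin l => (0 : ℝ)) (fun _ => 1) ⊆ regularSet l M := by
  rintro ⟨p, u⟩ ⟨hp, hu⟩ s i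
  have hT := tfull_strictMono hp
  have h1 : Tfull p i.castSucc.castSucc < Tfull p (Fin.last (M + 1)).castSucc :=
    hT (Fin.castSucc_lt_castSucc_iff.2 (Fin.castSucc_lt_last i))
  have h2 : Tfull p (Fin.last (M + 1)).castSucc < Tfull p (Fin.last (M + 2)) :=
    hT (Fin.castSucc_lt_last _)
  have h3 : 0 ≤ (Tfull p (Fin.last (M + 2)) - Tfull p (Fin.last (M + 1)).castSucc) * u s :=
    mul_nonneg (sub_pos.2 h2).le (hu.1 s)
  dsimp only
  linarith

/-- The integrand at a rescaled point splits into a power of the length of the interval, a fixed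
kernel on the unit simplex, and a smooth factor. -/
theorem cGint_add_smul (l M : ℕ) (γ : ℂ) (α : Fin (M + 2 + 1) → ℂ) (p : ℝ × (Fin (M + 2) → ℝ))
    (hp : p ∈ OrdDomain (M + 2)) (u : Fin l → ℝ) :
    CGint l (M + 2) γ α (Tfull p) ((fun _ => Tfull p (Fin.last (M + 1)).castSucc) +
        (Tfull p (Fin.last (M + 2)) - Tfull p (Fin.last (M + 1)).castSucc) • u) =
      ((∏ _s : Fin l,
        ((Tfull p (Fin.last (M + 2)) - Tfull p (Fin.last (M + 1)).castSucc : ℝ) : ℂ) ^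
          (-(γ * α (Fin.last (M + 1)).castSucc) / 2) *
        ((Tfull p (Fin.last (M + 2)) - Tfull p (Fin.last (M + 1)).castSucc : ℝ) : ℂ) ^
          (-(γ * α (Fin.last (M + 2))) / 2)) *
        ∏ s : Fin l, ∏ _s' ∈ Finset.Iio s,
          ((Tfull p (Fin.last (M + 2)) - Tfull p (Fin.last (M + 1)).castSucc : ℝ) : ℂ) ^
            (-(γ ^ 2) / 2)) *
      (simplexKernel l (-(γ * α (Fin.last (M + 1)).castSucc) / 2)
          (-(γ * α (Fin.last (M + 2))) / 2) (-(γ ^ 2) / 2) u *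
        regularFactor l M (fun i => -(γ * α i.castSucc.castSucc) / 2) (p, u)) := by
  have hR : 0 < Tfull p (Fin.last (M + 2)) - Tfull p (Fin.last (M + 1)).castSucc :=
    sub_pos.2 (tfull_strictMono hp (Fin.castSucc_lt_last _))
  simp only [CGint, simplexKernel, regularFactor, Fin.prod_univ_castSucc (n := M + 2),
    Fin.prod_univ_castSucc (n := M + 1), Pi.add_apply, Pi.smul_apply, smul_eq_mul]
  generalize Tfull p (Fin.last (M + 1)).castSucc = A at *
  generalize Tfull p (Fin.last (M + 2)) = B at *
  have e1 : ∀ s, A + (B - A) * u s - A = (B - A) * u s := fun s => by ring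
  have e2 : ∀ s, A + (B - A) * u s - B = (B - A) * (u s - 1) := fun s => by ring
  have e3 : ∀ s s', A + (B - A) * u s - (A + (B - A) * u s') = (B - A) * (u s - u s') :=
    fun s s' => by ring
  simp only [e1, e2, e3, ofReal_pos_mul_cpow hR, Finset.prod_mul_distrib]
  ring

/-- With `γ = ib` (`b > 0`), `χ = γ/2` or `2/γ`, `α₀ = −(r−1)χ`, `α_{N−1} = ia`,
`α_N = ia'` (`a, a' > 0`, `ab/2 ≥ r`, `a'b/2 ≥ r`): for every fixed point of the
ordered domain the Coulomb gas integrand is (absolutely) integrable over the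
simplex `{t_{N−1} < x₁ < ⋯ < x_l < t_N}`, and `C^{(l)}` is `r` times continuously
differentiable on the ordered domain `{t < t₁ < ⋯ < t_N}`. -/
theorem CoulombGas_integrable_and_Cr (r l N : ℕ) (hr : 1 ≤ r) (hl : 1 ≤ l) (hN : 2 ≤ N)
    (b a a' : ℝ) (hb : 0 < b) (ha : 0 < a) (ha' : 0 < a')
    (γ χ : ℂ) (hγ : γ = b * Complex.I) (hχ : χ = γ / 2 ∨ χ = 2 / γ)
    (α : Fin (N + 1) → ℂ)
    (hα0 : α 0 = -((r : ℂ) - 1) * χ)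
    (hαN1 : α ⟨N - 1, by omega⟩ = a * Complex.I)
    (hαN : α ⟨N, by omega⟩ = a' * Complex.I)
    (hmom1 : (r : ℝ) ≤ a * b / 2) (hmom2 : (r : ℝ) ≤ a' * b / 2) :
    (∀ p ∈ OrdDomain N,
        IntegrableOn (CGint l N γ α (Tfull p))
          (Simplex l (p.2 ⟨N - 2, by omega⟩) (p.2 ⟨N - 1, by omega⟩)) volume) ∧
      ContDiffOn ℝ (r : ℕ∞) (CoulombC l N hN γ α) (OrdDomain N) := by
  obtain ⟨M, rfl⟩ := Nat.exists_eq_add_of_le' hN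
  have hα1' : α (Fin.last (M + 1)).castSucc = a * Complex.I := hαN1
  have hα2' : α (Fin.last (M + 2)) = a' * Complex.I := hαN
  have hr0 : (0 : ℝ) ≤ r := Nat.cast_nonneg r
  have hc : -(γ * α (Fin.last (M + 1)).castSucc) / 2 = ((a * b / 2 : ℝ) : ℂ) := by
    rw [hα1', hγ]; push_cast; linear_combination (-(a * b / 2 : ℂ)) * Complex.I_sq
  have hc' : -(γ * α (Fin.last (M + 2))) / 2 = ((a' * b / 2 : ℝ) : ℂ) := by
    rw [hα2', hγ]; push_cast; linear_combination (-(a' * b / 2 : ℂ)) * Complex.I_sq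
  have hd : -(γ ^ 2) / 2 = ((b ^ 2 / 2 : ℝ) : ℂ) := by
    rw [hγ]; push_cast; linear_combination (-(b ^ 2 / 2 : ℂ)) * Complex.I_sq
  have hker : IntegrableOn (simplexKernel l (-(γ * α (Fin.last (M + 1)).castSucc) / 2)
      (-(γ * α (Fin.last (M + 2))) / 2) (-(γ ^ 2) / 2)) (Simplex l 0 1) := by
    rw [hc, hc', hd]
    exact integrableOn_simplexKernel l (hr0.trans hmom1) (hr0.trans hmom2) (by positivity)
  have hlt : ∀ p ∈ OrdDomain (M + 2),
      Tfull p (Fin.last (M + 1)).castSucc < Tfull p (Fin.last (M + 2)) :=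
    fun p hp => tfull_strictMono hp (Fin.castSucc_lt_last _)
  have hFsmooth : ∀ n : WithTop ℕ∞, ContDiffOn ℝ n
      (regularFactor l M (fun i => -(γ * α i.castSucc.castSucc) / 2)) (regularSet l M) :=
    fun n => contDiffOn_regularFactor _
  refine ⟨fun p hp => ?_, ?_⟩
  · change IntegrableOn _ (Simplex l (Tfull p (Fin.last (M + 1)).castSucc)
      (Tfull p (Fin.last (M + 2)))) volume
    rw [integrableOn_simplex_iff (hlt p hp)]
    simp only [cGint_add_smul l M γ α p hp]
    refine Integrable.const_mul ?_ _
    have hcont : ContinuousOn (fun u => regularFactor l M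
        (fun i => -(γ * α i.castSucc.castSucc) / 2) (p, u))
        (Set.Icc (fun _ : Fin l => (0 : ℝ)) (fun _ => 1)) :=
      (hFsmooth 0).continuousOn.comp (by fun_prop)
        fun u hu => ordDomain_prod_Icc_subset_regularSet l M ⟨hp, hu⟩
    obtain ⟨C, hC⟩ := isCompact_Icc.exists_bound_of_continuousOn hcont
    refine Integrable.mul_bdd (c := C) hker
      ((hcont.mono (simplex_subset_Icc l 0 1)).aestronglyMeasurable
        (isOpen_simplex l 0 1).measurableSet) ?_
    exact (ae_restrict_iff' (isOpen_simplex l 0 1).measurableSet).2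
      (ae_of_all _ fun u hu => hC u (simplex_subset_Icc l 0 1 hu))
  · have hint := contDiffOn_setIntegral_mul (n := (r : ℕ∞)) (μ := volume) isCompact_Icc
      (isOpen_simplex l 0 1).measurableSet (simplex_subset_Icc l 0 1) (isOpen_regularSet l M)
      (ordDomain_prod_Icc_subset_regularSet l M) hker (hFsmooth _)
    have hpow : ∀ (i j : Fin (M + 2 + 1)) (c : ℂ), i < j → ContDiffOn ℝ (r : ℕ∞)
        (fun p : ℝ × (Fin (M + 2) → ℝ) => ((Tfull p j - Tfull p i : ℝ) : ℂ) ^ c)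
        (OrdDomain (M + 2)) := fun i j c hij =>
      ((contDiff_tfull j).sub (contDiff_tfull i)).contDiffOn.ofReal_cpow_const
        (fun p hp => sub_pos.2 (tfull_strictMono hp hij)) c
    have hlast : (Fin.last (M + 1)).castSucc < Fin.last (M + 2) := Fin.castSucc_lt_last _
    have hR : ContDiffOn ℝ (r : ℕ∞) (fun p : ℝ × (Fin (M + 2) → ℝ) =>
        ((Tfull p (Fin.last (M + 2)) - Tfull p (Fin.last (M + 1)).castSucc : ℝ) : ℂ))
        (OrdDomain (M + 2)) :=
      (Complex.ofRealCLM.contDiff.comp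
        ((contDiff_tfull _).sub (contDiff_tfull _))).contDiffOn
    refine ContDiffOn.congr (ContDiffOn.mul
      (contDiffOn_prod fun (i : Fin (M + 2 + 1)) (_ : i ∈ Finset.univ) =>
        contDiffOn_prod fun (j : Fin (M + 2 + 1)) (hj : j ∈ Finset.Ioi i) =>
        hpow i j (-(α i * α j) / 2) (Finset.mem_Ioi.1 hj))
      ((hR.pow l).mul ((((contDiffOn_prod fun (_ : Fin l) (_ : _ ∈ Finset.univ) =>
        (hpow _ _ (-(γ * α (Fin.last (M + 1)).castSucc) / 2) hlast).mul
          (hpow _ _ (-(γ * α (Fin.last (M + 2))) / 2) hlast)).mul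
        (contDiffOn_prod fun (s : Fin l) (_ : _ ∈ Finset.univ) =>
          contDiffOn_prod fun (_ : Fin l) (_ : _ ∈ Finset.Iio s) =>
          hpow _ _ (-(γ ^ 2) / 2) hlast))).mul hint))) fun p hp => ?_
    change _ * ∫ x in Simplex l (Tfull p (Fin.last (M + 1)).castSucc)
      (Tfull p (Fin.last (M + 2))), CGint l (M + 2) γ α (Tfull p) x = _
    rw [setIntegral_simplex (hlt p hp)]
    simp only [cGint_add_smul l M γ α p hp, integral_const_mul]
end

section
/- Let r ≥ 1 be an integer, γ ∈ ℂ∖{0}, χ ∈ ℂ, α_1,…,α_N ∈ ℂ, Q = γ/2 + 2/γ, and Δ_l = (α_l/2)(Q − α_l/2). For n ≥ 1 set P_n(t,𝐭) = Σ_{l=1}^N α_l / (2(t_l − t)^n), and for a tuple 𝐧 = (n_1,…,n_m) of positive integers set P_𝐧 = ∏_{i=1}^m P_{n_i} (P_𝐧 = 1 if m = 0). Then for every integer n ≥ 1, at every point of the ordered domain {t < t_1 < ⋯ < t_N}: L_{-n}(P_𝐧 · f) = [ Σ_{i=1}^m n_i · P_{n_i + n} · ∏_{i'≠i} P_{n_{i'}}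 − ( Σ_{i=1}^{n−1} P_i P_{n−i} ) · P_𝐧 + ( (n−1)Q − (r−1)χ ) · P_n · P_𝐧 ] · f, where Σ_{i=1}^{0} denotes the empty sum. -/
open scoped BigOperators

/-- The first-order differential operator `L_{-n}` acting on functions of
`(t, t₁, …, t_N) ∈ ℝ × (Fin N → ℝ)`. -/
noncomputable def Lop (N : ℕ) (Δ : Fin N → ℂ) (n : ℕ)
    (F : ℝ × (Fin N → ℝ) → ℂ) (p : ℝ × (Fin N → ℝ)) : ℂ :=
  if n = 1 then fderiv ℝ F p (1, 0)
  else ∑ l : Fin N,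
    (-((((p.2 l : ℂ) - (p.1 : ℂ)) ^ (n - 1))⁻¹) * fderiv ℝ F p (0, Pi.single l 1)
      + Δ l * ((n : ℂ) - 1) * ((((p.2 l : ℂ) - (p.1 : ℂ)) ^ n)⁻¹) * F p)

/-- The Coulomb gas integrand
`f(t,𝐭) = ∏_{i<j} (t_j − t_i)^{−α_iα_j/2} · ∏_i (t_i − t)^{(r−1)χα_i/2}`. -/
noncomputable def fCG (N : ℕ) (r : ℕ) (χ : ℂ) (α : Fin N → ℂ)
    (p : ℝ × (Fin N → ℝ)) : ℂ :=
  (∏ i : Fin N, ∏ j ∈ Finset.Ioi i,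
      (((p.2 j - p.2 i : ℝ) : ℂ) ^ (-(α i * α j) / 2))) *
    ∏ i : Fin N, (((p.2 i - p.1 : ℝ) : ℂ) ^ (((r : ℂ) - 1) * χ * α i / 2))

/-- `P_n(t,𝐭) = Σ_{l=1}^N α_l / (2 (t_l − t)^n)`. -/
noncomputable def Pfun (N : ℕ) (α : Fin N → ℂ) (n : ℕ) (p : ℝ × (Fin N → ℝ)) : ℂ :=
  ∑ l : Fin N, α l / (2 * (((p.2 l : ℂ) - (p.1 : ℂ)) ^ n))

/-- Partial-fraction form of a geometric sum in `x⁻¹` and `y⁻¹`. -/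
lemma sum_inv_pow_mul_inv_pow {K : Type*} [Field K] {x y : K} (hx : x ≠ 0) (hy : y ≠ 0)
    (hxy : x ≠ y) {n : ℕ} (hn : 1 ≤ n) :
    ∑ k ∈ Finset.Icc 1 (n - 1), (x ^ k)⁻¹ * (y ^ (n - k))⁻¹
      = -((x ^ (n - 1))⁻¹ - (y ^ (n - 1))⁻¹) / (x - y) := by
  obtain ⟨m, rfl⟩ := Nat.exists_eq_add_of_le' hn
  have hd : x - y ≠ 0 := sub_ne_zero.mpr hxy
  have hg := geom_sum₂_mul x⁻¹ y⁻¹ m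
  have hsum : ∑ k ∈ Finset.Icc 1 m, (x ^ k)⁻¹ * (y ^ (m + 1 - k))⁻¹
      = x⁻¹ * y⁻¹ * ∑ i ∈ Finset.range m, x⁻¹ ^ i * y⁻¹ ^ (m - 1 - i) := by
    rw [Finset.mul_sum, ← Finset.Ico_add_one_right_eq_Icc, Finset.sum_Ico_eq_sum_range]
    refine Finset.sum_congr (by simp) fun i hi => ?_
    have hi' : i < m := by simpa using hi
    rw [show m + 1 - (1 + i) = (m - 1 - i) + 1 by omega, ← inv_pow, ← inv_pow]
    ring
  have hfac : x⁻¹ - y⁻¹ = -(x - y) * (x⁻¹ * y⁻¹) := by field_simp; ring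
  rw [Nat.add_sub_cancel, hsum, eq_div_iff hd, ← inv_pow, ← inv_pow, ← hg, hfac]
  ring

lemma Pfun_mul_Pfun (N : ℕ) (α : Fin N → ℂ) (a b : ℕ) (p : ℝ × (Fin N → ℝ)) :
    Pfun N α a p * Pfun N α b p = ∑ i : Fin N, ∑ j : Fin N, α i * α j / 4 *
      ((((p.2 i : ℂ) - p.1) ^ a)⁻¹ * (((p.2 j : ℂ) - p.1) ^ b)⁻¹) := by
  simp only [Pfun, Finset.sum_mul_sum]
  refine Finset.sum_congr rfl fun i _ => Finset.sum_congr rfl fun j _ => ?_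
  rw [div_eq_mul_inv, div_eq_mul_inv, mul_inv, mul_inv]
  ring

lemma sub_ne_zero_of_mem_ordDomain {N : ℕ} {p : ℝ × (Fin N → ℝ)} (hp : p ∈ OrdDomain N)
    (l : Fin N) :
    (p.2 l : ℂ) - p.1 ≠ 0 := by
  exact_mod_cast (sub_pos.mpr (hp.1 l)).ne'

/-- Separating the diagonal in `∑ k, P_k P_{n-k}` and pairing the terms `(i, j)` and `(j, i)`. -/
lemma sum_Pfun_mul_Pfun {N : ℕ} (α : Fin N → ℂ) {n : ℕ} (hn : 1 ≤ n)
    {p : ℝ × (Fin N → ℝ)} (hp : p ∈ OrdDomain N) :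
    ∑ k ∈ Finset.Icc 1 (n - 1), Pfun N α k p * Pfun N α (n - k) p
      = ((n : ℂ) - 1) * ∑ i : Fin N, α i ^ 2 / 4 * (((p.2 i : ℂ) - p.1) ^ n)⁻¹
        + ∑ i : Fin N, ∑ j ∈ Finset.Ioi i, -(α i * α j) / 2 *
          ((((p.2 j : ℂ) - p.1) ^ (n - 1))⁻¹ - (((p.2 i : ℂ) - p.1) ^ (n - 1))⁻¹)
            / ((p.2 j : ℂ) - p.2 i) := by
  set g : Fin N → Fin N → ℂ := fun i j => α i * α j / 4 * ∑ k ∈ Finset.Icc 1 (n - 1),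
    ((((p.2 i : ℂ) - p.1) ^ k)⁻¹ * (((p.2 j : ℂ) - p.1) ^ (n - k))⁻¹) with hg
  have h1 : ∑ k ∈ Finset.Icc 1 (n - 1), Pfun N α k p * Pfun N α (n - k) p
      = ∑ i, ∑ j, g i j := by
    simp only [Pfun_mul_Pfun, hg, Finset.mul_sum]
    rw [Finset.sum_comm]
    exact Finset.sum_congr rfl fun i _ => Finset.sum_comm
  have h2 : ∀ i, ∑ j, g i j = g i i + ∑ j ∈ ({i}ᶜ : Finset (Fin N)), g i j := fun i =>
    Fintype.sum_eq_add_sum_compl i _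
  have hdiag : ∀ i, g i i = ((n : ℂ) - 1) * (α i ^ 2 / 4 * (((p.2 i : ℂ) - p.1) ^ n)⁻¹) := by
    intro i
    have : ∀ k ∈ Finset.Icc 1 (n - 1), (((p.2 i : ℂ) - p.1) ^ k)⁻¹ *
        (((p.2 i : ℂ) - p.1) ^ (n - k))⁻¹ = (((p.2 i : ℂ) - p.1) ^ n)⁻¹ := by
      intro k hk
      rw [Finset.mem_Icc] at hk
      rw [← mul_inv, ← pow_add, show k + (n - k) = n by omega]
    simp only [hg]
    rw [Finset.sum_congr rfl this]
    simp only [Finset.sum_const, Nat.card_Icc, nsmul_eq_mul, Nat.add_sub_cancel,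
      Nat.cast_sub hn, Nat.cast_one]
    ring
  rw [h1, Finset.sum_congr rfl fun i _ => h2 i, Finset.sum_add_distrib,
    ← Finset.sum_sum_Ioi_add_eq_sum_sum_off_diag, Finset.mul_sum,
    Finset.sum_congr rfl fun i _ => hdiag i]
  congr 1
  refine Finset.sum_congr rfl fun i _ => Finset.sum_congr rfl fun j hj => ?_
  have hij : p.2 i < p.2 j := hp.2 (Finset.mem_Ioi.mp hj)
  have hne : (p.2 j : ℂ) - p.1 ≠ (p.2 i : ℂ) - p.1 := by
    intro h
    exact hij.ne' (by exact_mod_cast sub_left_injective h)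
  simp only [hg]
  have hi := sub_ne_zero_of_mem_ordDomain hp i
  have hj := sub_ne_zero_of_mem_ordDomain hp j
  rw [sum_inv_pow_mul_inv_pow hj hi hne hn, sum_inv_pow_mul_inv_pow hi hj hne.symm hn,
    sub_sub_sub_cancel_right, sub_sub_sub_cancel_right, ← neg_sub (p.2 j : ℂ), div_neg]
  ring

lemma differentiableAt_ofReal_cpow {E : Type*} [NormedAddCommGroup E] [NormedSpace ℝ E]
    (L : E →L[ℝ] ℝ) (β : ℂ) {p : E} (hp : 0 < L p) :
    DifferentiableAt ℝ (fun q => ((L q : ℝ) : ℂ) ^ β) p ∧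
      ∀ v, fderiv ℝ (fun q => ((L q : ℝ) : ℂ) ^ β) p v
        = β * (L v : ℂ) / (L p : ℂ) * ((L p : ℝ) : ℂ) ^ β := by
  have h1 : HasDerivAt (fun z : ℂ => z ^ β) (β * (L p : ℂ) ^ (β - 1)) (L p : ℂ) := by
    simpa using (hasDerivAt_id (L p : ℂ)).cpow_const (c := β) (Or.inl (by simpa using hp))
  have h2 := h1.comp_ofReal.hasFDerivAt.comp p L.hasFDerivAt
  have h0 : (L p : ℂ) ≠ 0 := by exact_mod_cast hp.ne'
  refine ⟨h2.differentiableAt, fun v => ?_⟩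
  have h3 : fderiv ℝ (fun q => ((L q : ℝ) : ℂ) ^ β) p = _ := h2.fderiv
  rw [h3, Complex.cpow_sub _ _ h0, Complex.cpow_one]
  simp
  ring

/-- If each factor has logarithmic derivative `c i` along `v`, the product has `∑ i, c i`. -/
lemma fderiv_finsetProd_apply_of_log {E ι : Type*} [NormedAddCommGroup E] [NormedSpace ℝ E]
    (s : Finset ι) (F : ι → E → ℂ) (c : ι → ℂ) {p v : E}
    (hF : ∀ i ∈ s, DifferentiableAt ℝ (F i) p ∧ fderiv ℝ (F i) p v = c i * F i p) :
    DifferentiableAt ℝ (fun q => ∏ i ∈ s, F i q) p ∧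
      fderiv ℝ (fun q => ∏ i ∈ s, F i q) p v = (∑ i ∈ s, c i) * ∏ i ∈ s, F i p := by
  classical
  have h := HasFDerivAt.finsetProd fun i hi => (hF i hi).1.hasFDerivAt
  refine ⟨h.differentiableAt, ?_⟩
  rw [h.fderiv, Finset.sum_mul]
  simp only [sum_apply, smul_apply, smul_eq_mul]
  refine Finset.sum_congr rfl fun i hi => ?_
  rw [(hF i hi).2, ← Finset.prod_erase_mul s _ hi]
  ring

lemma fderiv_fCG {N : ℕ} (r : ℕ) (χ : ℂ) (α : Fin N → ℂ) {p : ℝ × (Fin N → ℝ)}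
    (hp : p ∈ OrdDomain N) (v : ℝ × (Fin N → ℝ)) :
    DifferentiableAt ℝ (fCG N r χ α) p ∧ fderiv ℝ (fCG N r χ α) p v =
      ((∑ i : Fin N, ∑ j ∈ Finset.Ioi i,
          -(α i * α j) / 2 * ((v.2 j - v.2 i : ℝ) : ℂ) / ((p.2 j - p.2 i : ℝ) : ℂ))
        + ∑ i : Fin N, ((r : ℂ) - 1) * χ * α i / 2 * ((v.2 i - v.1 : ℝ) : ℂ)
            / ((p.2 i - p.1 : ℝ) : ℂ)) * fCG N r χ α p := by
  let X : Fin N → (ℝ × (Fin N → ℝ)) →L[ℝ] ℝ := fun i =>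
    (ContinuousLinearMap.proj i).comp (ContinuousLinearMap.snd ℝ ℝ (Fin N → ℝ))
  have hA := fderiv_finsetProd_apply_of_log Finset.univ _ _ (p := p) (v := v) fun i _ =>
    fderiv_finsetProd_apply_of_log (Finset.Ioi i) _ _ fun j hj =>
      have h := differentiableAt_ofReal_cpow (X j - X i) (-(α i * α j) / 2) (p := p)
        (sub_pos.mpr (hp.2 (Finset.mem_Ioi.mp hj)))
      ⟨h.1, h.2 v⟩
  have hB := fderiv_finsetProd_apply_of_log Finset.univ _ _ (p := p) (v := v) fun i _ =>
    have h := differentiableAt_ofReal_cpow (X i - ContinuousLinearMap.fst ℝ ℝ (Fin N → ℝ))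
      (((r : ℂ) - 1) * χ * α i / 2) (p := p) (sub_pos.mpr (hp.1 i))
    ⟨h.1, h.2 v⟩
  have h := hA.1.hasFDerivAt.mul hB.1.hasFDerivAt
  refine ⟨h.differentiableAt, ?_⟩
  have h' : fderiv ℝ (fCG N r χ α) p = _ := h.fderiv
  rw [h']
  simp only [add_apply, smul_apply, smul_eq_mul,
    hA.2, hB.2]
  simp only [fCG, X, sub_apply, ContinuousLinearMap.comp_apply,
    ContinuousLinearMap.proj_apply, ContinuousLinearMap.coe_snd', ContinuousLinearMap.coe_fst']
  ring

lemma fderiv_Pfun {N : ℕ} (α : Fin N → ℂ) (k : ℕ) {p : ℝ × (Fin N → ℝ)}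
    (hp : p ∈ OrdDomain N) (v : ℝ × (Fin N → ℝ)) :
    DifferentiableAt ℝ (Pfun N α k) p ∧ fderiv ℝ (Pfun N α k) p v =
      ∑ l : Fin N, -(k : ℂ) * (α l / 2) * ((v.2 l - v.1 : ℝ) : ℂ)
        * (((p.2 l : ℂ) - p.1) ^ (k + 1))⁻¹ := by
  let X : Fin N → (ℝ × (Fin N → ℝ)) →L[ℝ] ℝ := fun l =>
    (ContinuousLinearMap.proj l).comp (ContinuousLinearMap.snd ℝ ℝ (Fin N → ℝ))
      - ContinuousLinearMap.fst ℝ ℝ (Fin N → ℝ)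
  have hX : ∀ l q, X l q = q.2 l - q.1 := fun _ _ => rfl
  have hl : ∀ l, HasFDerivAt (fun q : ℝ × (Fin N → ℝ) => α l / 2 * ((X l q : ℝ) : ℂ) ^ (-(k : ℂ)))
      ((α l / 2) • fderiv ℝ (fun q => ((X l q : ℝ) : ℂ) ^ (-(k : ℂ))) p) p := fun l =>
    (differentiableAt_ofReal_cpow (X l) (-(k : ℂ)) (sub_pos.mpr (hp.1 l))).1.hasFDerivAt.const_mul _
  have h := HasFDerivAt.fun_sum (u := Finset.univ) fun l _ => hl l
  have hP : Pfun N α k = fun q => ∑ l, α l / 2 * ((X l q : ℝ) : ℂ) ^ (-(k : ℂ)) := by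
    funext q
    refine Finset.sum_congr rfl fun l _ => ?_
    rw [Complex.cpow_neg, Complex.cpow_natCast, hX, Complex.ofReal_sub, div_mul_eq_div_div,
      div_eq_mul_inv]
  rw [← hP] at h
  refine ⟨h.differentiableAt, ?_⟩
  rw [h.fderiv]
  simp only [sum_apply, smul_apply, smul_eq_mul]
  refine Finset.sum_congr rfl fun l _ => ?_
  rw [(differentiableAt_ofReal_cpow (X l) (-(k : ℂ)) (sub_pos.mpr (hp.1 l))).2,
    Complex.cpow_neg, Complex.cpow_natCast, hX, hX, Complex.ofReal_sub (p.2 l), pow_succ, mul_inv]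
  ring

/-- The derivative of `P_𝐧 f` along a vector `v` with `v_l - v_0 = -(t_l - t)^{-(n-1)}`. -/
lemma fderiv_prod_Pfun_mul_fCG {N : ℕ} (r : ℕ) (χ : ℂ) (α : Fin N → ℂ) {m : ℕ}
    (nn : Fin m → ℕ) {n : ℕ} (hn : 1 ≤ n) {p : ℝ × (Fin N → ℝ)} (hp : p ∈ OrdDomain N)
    (v : ℝ × (Fin N → ℝ)) (hv : ∀ l, v.2 l - v.1 = -((p.2 l - p.1) ^ (n - 1))⁻¹) :
    fderiv ℝ (fun q => (∏ i : Fin m, Pfun N α (nn i) q) * fCG N r χ α q) p v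
      = ((∑ i : Fin m, (nn i : ℂ) * Pfun N α (nn i + n) p *
            ∏ i' ∈ Finset.univ.erase i, Pfun N α (nn i') p)
          + (-(∑ k ∈ Finset.Icc 1 (n - 1), Pfun N α k p * Pfun N α (n - k) p)
              + ((n : ℂ) - 1) * ∑ i : Fin N, α i ^ 2 / 4 * (((p.2 i : ℂ) - p.1) ^ n)⁻¹
              - ((r : ℂ) - 1) * χ * Pfun N α n p) *
            ∏ i : Fin m, Pfun N α (nn i) p) * fCG N r χ α p := by
  have hvC : ∀ l, ((v.2 l - v.1 : ℝ) : ℂ) = -(((p.2 l : ℂ) - p.1) ^ (n - 1))⁻¹ := fun l => by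
    rw [hv]; push_cast; rfl
  have hP : ∀ k, fderiv ℝ (Pfun N α k) p v = k * Pfun N α (k + n) p := by
    intro k
    rw [(fderiv_Pfun α k hp v).2, Pfun, Finset.mul_sum]
    refine Finset.sum_congr rfl fun l _ => ?_
    rw [hvC, show k + n = (k + 1) + (n - 1) by omega, pow_add _ (k + 1), div_eq_mul_inv _ (2 * _),
      mul_inv, mul_inv]
    ring
  have hf : fderiv ℝ (fCG N r χ α) p v
      = (-(∑ k ∈ Finset.Icc 1 (n - 1), Pfun N α k p * Pfun N α (n - k) p)
          + ((n : ℂ) - 1) * (∑ i : Fin N, α i ^ 2 / 4 * (((p.2 i : ℂ) - p.1) ^ n)⁻¹)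
          - ((r : ℂ) - 1) * χ * Pfun N α n p) * fCG N r χ α p := by
    rw [(fderiv_fCG r χ α hp v).2, sum_Pfun_mul_Pfun α hn hp, neg_add, neg_add_cancel_comm,
      sub_eq_add_neg _ (_ * Pfun N α n p), Pfun, Finset.mul_sum, ← Finset.sum_neg_distrib,
      ← Finset.sum_neg_distrib]
    congr 2
    · refine Finset.sum_congr rfl fun i _ => ?_
      rw [← Finset.sum_neg_distrib]
      refine Finset.sum_congr rfl fun j _ => ?_
      rw [show v.2 j - v.2 i = (v.2 j - v.1) - (v.2 i - v.1) by ring,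
        Complex.ofReal_sub (v.2 j - v.1), hvC, hvC, Complex.ofReal_sub]
      ring
    · refine Finset.sum_congr rfl fun i _ => ?_
      have hpow : ((p.2 i : ℂ) - p.1) ^ n = ((p.2 i : ℂ) - p.1) ^ (n - 1)
          * ((p.2 i : ℂ) - p.1) := by
        rw [← pow_succ, Nat.sub_add_cancel hn]
      rw [hvC, Complex.ofReal_sub, hpow, div_eq_mul_inv _ (2 * _), mul_inv, mul_inv]
      ring
  have hprod := HasFDerivAt.finsetProd (u := Finset.univ) fun i _ =>
    (fderiv_Pfun α (nn i) hp v).1.hasFDerivAt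
  have h := hprod.fun_mul (fderiv_fCG r χ α hp v).1.hasFDerivAt
  rw [h.fderiv]
  simp only [add_apply, smul_apply, smul_eq_mul,
    sum_apply, hP, hf]
  rw [Finset.sum_congr rfl fun i _ => mul_comm _ ((nn i : ℂ) * Pfun N α (nn i + n) p)]
  ring

/-- `L_{-n}(P_𝐧 f) = [ Σ_i n_i P_{n_i+n} ∏_{i'≠i} P_{n_{i'}}
  − (Σ_{i=1}^{n−1} P_i P_{n−i}) P_𝐧 + ((n−1)Q − (r−1)χ) P_n P_𝐧 ] · f`
at every point of the ordered domain `{t < t₁ < ⋯ < t_N}`. -/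
theorem Lop_Pn_f (N : ℕ) (hN : 1 ≤ N) (r : ℕ) (hr : 1 ≤ r)
    (γ χ : ℂ) (hγ : γ ≠ 0) (α : Fin N → ℂ)
    (m : ℕ) (nn : Fin m → ℕ) (hnn : ∀ i, 1 ≤ nn i) (n : ℕ) (hn : 1 ≤ n) :
    ∀ p ∈ OrdDomain N,
      Lop N (fun l => α l / 2 * ((γ / 2 + 2 / γ) - α l / 2)) n
          (fun q => (∏ i : Fin m, Pfun N α (nn i) q) * fCG N r χ α q) p
        = ((∑ i : Fin m, (nn i : ℂ) * Pfun N α (nn i + n) p *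
              ∏ i' ∈ Finset.univ.erase i, Pfun N α (nn i') p)
            - (∑ i ∈ Finset.Icc 1 (n - 1), Pfun N α i p * Pfun N α (n - i) p) *
                ∏ i : Fin m, Pfun N α (nn i) p
            + (((n : ℂ) - 1) * (γ / 2 + 2 / γ) - ((r : ℂ) - 1) * χ) * Pfun N α n p *
                ∏ i : Fin m, Pfun N α (nn i) p) * fCG N r χ α p := by
  intro p hp
  rcases eq_or_lt_of_le hn with rfl | hn'
  · rw [Lop, if_pos rfl, fderiv_prod_Pfun_mul_fCG r χ α nn le_rfl hp (1, 0) fun l => by simp]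
    push_cast
    ring
  · set F := fun q => (∏ i : Fin m, Pfun N α (nn i) q) * fCG N r χ α q with hF
    let w : Fin N → ℝ := fun l => -((p.2 l - p.1) ^ (n - 1))⁻¹
    have hsum : ∑ l : Fin N, -((((p.2 l : ℂ) - (p.1 : ℂ)) ^ (n - 1))⁻¹) *
        fderiv ℝ F p (0, Pi.single l 1) = fderiv ℝ F p (0, w) := by
      have hw : ((0 : ℝ), w) = ∑ l, w l • ((0 : ℝ), (Pi.single l 1 : Fin N → ℝ)) := by
        ext i
        · simp [Prod.fst_sum]
        · simp [Prod.snd_sum, Finset.sum_apply, Pi.single_apply]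
      rw [hw, map_sum]
      refine Finset.sum_congr rfl fun l _ => ?_
      rw [map_smul, Complex.real_smul]
      simp [w]
    have hΔ : ∑ l : Fin N, α l / 2 * ((γ / 2 + 2 / γ) - α l / 2) * ((n : ℂ) - 1) *
          ((((p.2 l : ℂ) - (p.1 : ℂ)) ^ n)⁻¹) * F p
        = ((n : ℂ) - 1) * ((γ / 2 + 2 / γ) * Pfun N α n p
          - ∑ l : Fin N, α l ^ 2 / 4 * (((p.2 l : ℂ) - p.1) ^ n)⁻¹) * F p := by
      rw [Pfun, Finset.mul_sum, ← Finset.sum_sub_distrib, Finset.mul_sum, Finset.sum_mul]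
      refine Finset.sum_congr rfl fun l _ => ?_
      rw [div_eq_mul_inv _ (2 * _), mul_inv]
      ring
    rw [Lop, if_neg hn'.ne', Finset.sum_add_distrib, hsum, hΔ, hF,
      fderiv_prod_Pfun_mul_fCG r χ α nn hn hp (0, w) fun l => by simp [w]]
    ring
end

section
/- Let r ≥ 1 and 0 ≤ n ≤ r be integers. Then there exist an integer m ≥ 1, real numbers t_1,…,t_m, and real coefficients c_1,…,c_m such that for all (x_1,…,x_r) ∈ ℝ^r one has Σ_{k=1}^m c_k · ∏_{s=1}^r (x_s − t_k) = e_n(x_1,…,x_r), where e_n denotes the n-th elementary symmetric polynomial in r variables (e_0 = 1). -/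
open scoped BigOperators

/-- For `r ≥ 1` and `0 ≤ n ≤ r`, the `n`-th elementary symmetric polynomial
`e_n(x₁,…,x_r) = Σ_{i₁<⋯<i_n} x_{i₁}⋯x_{i_n}` can be written as a finite real
linear combination `Σ_k c_k ∏_s (x_s − t_k)` of shifted products. -/
theorem esymm_as_combination_of_shifted_products (r n : ℕ) (hr : 1 ≤ r) (hn : n ≤ r) :
    ∃ (m : ℕ) (_ : 1 ≤ m) (t c : Fin m → ℝ),
      ∀ x : Fin r → ℝ,
        ∑ k : Fin m, c k * ∏ s : Fin r, (x s - t k)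
          = ∑ A ∈ Finset.powersetCard n (Finset.univ : Finset (Fin r)), ∏ i ∈ A, x i := by
  classical
  have hinj : Set.InjOn (fun k : Fin (r + 1) => ((k : ℕ) : ℝ))
      (Finset.univ : Finset (Fin (r + 1))) := fun a _ b _ h => Fin.ext (Nat.cast_injective h)
  refine ⟨r + 1, by omega, fun k => -((k : ℕ) : ℝ),
    fun k => (Lagrange.basis Finset.univ (fun k : Fin (r + 1) => ((k : ℕ) : ℝ)) k).coeff (r - n),
    fun x => ?_⟩
  set P : Polynomial ℝ := ∏ s : Fin r, (Polynomial.X + Polynomial.C (x s)) with hP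
  have hdeg : P.degree < (Finset.univ : Finset (Fin (r + 1))).card := by
    simp only [hP, Polynomial.degree_prod, Polynomial.degree_X_add_C, Finset.sum_const,
      Finset.card_univ, Fintype.card_fin, nsmul_eq_mul, mul_one]
    exact_mod_cast Nat.lt_succ_self r
  have hcoeff : P.coeff (r - n) =
      ∑ A ∈ Finset.powersetCard n (Finset.univ : Finset (Fin r)), ∏ i ∈ A, x i := by
    rw [hP, Finset.prod_X_add_C_coeff _ _ (by simp)]
    simp [Nat.sub_sub_self hn]
  rw [← hcoeff, Lagrange.eq_interpolate hinj hdeg, Lagrange.interpolate_apply,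
    Polynomial.finsetSum_coeff]
  refine Finset.sum_congr rfl fun k _ => ?_
  rw [Polynomial.coeff_C_mul, mul_comm]
  congr 1
  simp [hP, Polynomial.eval_prod, add_comm]
end
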